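/- Let 𝒳 = ℝ^d with metric c(x,y) = ‖x−y‖_2, let μ be Lebesgue measure on ℝ^d, let Q be a probability measure with pdf q with respect to μ, let ω_1, …, ω_n ∈ ℝ^d, let P̂_n := (1/n) Σ_{i=1}^n δ_{ω_i}, and let r > 0, s ≥ 1. For λ ≥ 0 and u ∈ ℝ^n define C_{λ,u}(x) := min_{1≤i≤n} (λ ‖x−ω_i‖_2^s − u_i) and η(λ,u) := ∫ q(x) e^{−C_{λ,u}(x)} dx. Suppose (λ*, u*) attains the maximum over λ ≥ 0, u ∈ ℝ^n of the dual objective −λ r^s + (1/n) Σ_{i=1}^n u_i − log η(λ,u), with 0 < η(λ*,u*) < ∞. Then the probability measure P* with Lebesgue density p*(x) := q(x) e^{−C_{λ*,u*}(x)} / η(λ*,u*) satisfies W_s(P*, P̂_n) ≤ r and KL(P*||Q) = inf { KL(P||Q) : P a Borel probability measure on ℝ^d with W_s(P, P̂_n) ≤ r }; that is, the least favorable distribution is an exponentially tilted version of the pre-change distribution. -/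

import Mathlib

open MeasureTheory
open scoped ENNReal

/-- Kullback–Leibler divergence `KL(P‖Q) = ∫ log (dP/dQ) dP` if `P ≪ Q` (and the
log-likelihood ratio is integrable), and `+∞` otherwise. -/
noncomputable def klDiv {𝒳 : Type*} [MeasurableSpace 𝒳] (P Q : Measure 𝒳) : ℝ≥0∞ :=
  open Classical in
  if P ≪ Q ∧ Integrable (fun x => Real.log (P.rnDeriv Q x).toReal) P then
    ENNReal.ofReal (∫ x, Real.log (P.rnDeriv Q x).toReal ∂P)
  else ∞

/-- `C_{λ,u}(x) = min_{1 ≤ i ≤ n} (λ c(x,ω_i)^s - u_i)`. -/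
noncomputable def Cfun {𝒳 : Type*} [PseudoMetricSpace 𝒳] {n : ℕ} (hn : 1 ≤ n) (s : ℝ)
    (ω : Fin n → 𝒳) (lam : ℝ) (u : Fin n → ℝ) (x : 𝒳) : ℝ :=
  Finset.univ.inf' ⟨⟨0, hn⟩, Finset.mem_univ _⟩ fun i => lam * dist x (ω i) ^ s - u i

/-- `η(λ,u) = ∫ q(x) e^{-C_{λ,u}(x)} dμ(x)` (as an extended nonnegative real). -/
noncomputable def etaFun {𝒳 : Type*} [PseudoMetricSpace 𝒳] [MeasurableSpace 𝒳] {n : ℕ}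
    (hn : 1 ≤ n) (s : ℝ) (ω : Fin n → 𝒳) (μ : Measure 𝒳) (q : 𝒳 → ℝ)
    (lam : ℝ) (u : Fin n → ℝ) : ℝ≥0∞ :=
  ∫⁻ x, ENNReal.ofReal (q x * Real.exp (-(Cfun hn s ω lam u x))) ∂μ

/-- The Wasserstein distance of order `s` (valued in `ℝ≥0∞`):
`W_s(P,P') = (inf_Γ ∫ c(x,y)^s dΓ)^{1/s}`, the infimum being over all couplings `Γ` of
`P` and `P'`, i.e. probability measures on the product with marginals `P` and `P'`. -/
noncomputable def wassE {𝒳 : Type*} [MeasurableSpace 𝒳] [PseudoMetricSpace 𝒳] (s : ℝ)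
    (P P' : Measure 𝒳) : ℝ≥0∞ :=
  (⨅ Γ ∈ {Γ : Measure (𝒳 × 𝒳) | IsProbabilityMeasure Γ ∧
      Γ.map Prod.fst = P ∧ Γ.map Prod.snd = P'},
    ∫⁻ p, ENNReal.ofReal (dist p.1 p.2 ^ s) ∂Γ) ^ (1 / s)

section Cfun

variable {𝒳 : Type*} [PseudoMetricSpace 𝒳] {n : ℕ} {hn : 1 ≤ n} {s : ℝ} {ω : Fin n → 𝒳}

lemma Cfun_le (lam : ℝ) (u : Fin n → ℝ) (x : 𝒳) (i : Fin n) :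
    Cfun hn s ω lam u x ≤ lam * dist x (ω i) ^ s - u i :=
  Finset.inf'_le _ (Finset.mem_univ i)

lemma le_Cfun_iff {lam : ℝ} {u : Fin n → ℝ} {x : 𝒳} {a : ℝ} :
    a ≤ Cfun hn s ω lam u x ↔ ∀ i, a ≤ lam * dist x (ω i) ^ s - u i := by
  exact (Finset.le_inf'_iff _ _).trans (by simp)

lemma exists_Cfun_eq (lam : ℝ) (u : Fin n → ℝ) (x : 𝒳) :
    ∃ i, Cfun hn s ω lam u x = lam * dist x (ω i) ^ s - u i := by
  obtain ⟨i, -, hi⟩ := Finset.exists_mem_eq_inf' (s := Finset.univ)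
    ⟨⟨0, hn⟩, Finset.mem_univ _⟩ fun i => lam * dist x (ω i) ^ s - u i
  exact ⟨i, hi⟩

lemma neg_sum_abs_le_Cfun {lam : ℝ} (hlam : 0 ≤ lam) (u : Fin n → ℝ) (x : 𝒳) :
    -∑ i, |u i| ≤ Cfun hn s ω lam u x := by
  refine le_Cfun_iff.2 fun i => ?_
  have h1 : |u i| ≤ ∑ i, |u i| :=
    Finset.single_le_sum (f := fun i => |u i|) (fun j _ => abs_nonneg _) (Finset.mem_univ i)
  have h2 : 0 ≤ lam * dist x (ω i) ^ s := by positivity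
  linarith [le_abs_self (u i)]

lemma Cfun_smul {a : ℝ} (ha : 0 ≤ a) (lam : ℝ) (u : Fin n → ℝ) (x : 𝒳) :
    Cfun hn s ω (a * lam) (fun i => a * u i) x = a * Cfun hn s ω lam u x := by
  apply le_antisymm
  · obtain ⟨i, hi⟩ := exists_Cfun_eq (hn := hn) (s := s) (ω := ω) lam u x
    rw [hi]
    exact (Cfun_le _ _ _ i).trans_eq (by ring)
  · refine le_Cfun_iff.2 fun i => ?_
    have := mul_le_mul_of_nonneg_left (Cfun_le (hn := hn) (s := s) (ω := ω) lam u x i) ha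
    linarith

lemma Cfun_add_mul_le {t : ℝ} (ht : 0 ≤ t) (lam lam' : ℝ) (u u' : Fin n → ℝ) (x : 𝒳) :
    Cfun hn s ω lam u x + t * Cfun hn s ω lam' u' x ≤
      Cfun hn s ω (lam + t * lam') (fun i => u i + t * u' i) x := by
  refine le_Cfun_iff.2 fun i => ?_
  have h1 := mul_le_mul_of_nonneg_left (Cfun_le (hn := hn) (s := s) (ω := ω) lam' u' x i) ht
  have h2 := Cfun_le (hn := hn) (s := s) (ω := ω) lam u x i
  linarith

lemma measurable_Cfun [MeasurableSpace 𝒳] [OpensMeasurableSpace 𝒳] (lam : ℝ) (u : Fin n → ℝ) :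
    Measurable (Cfun hn s ω lam u) := by
  refine measurable_of_Ici fun a => ?_
  have h : Cfun hn s ω lam u ⁻¹' Set.Ici a =
      ⋂ i, {x | a ≤ lam * dist x (ω i) ^ s - u i} := by
    ext x
    simp only [Set.mem_preimage, Set.mem_Ici, le_Cfun_iff, Set.mem_iInter, Set.mem_ofPred_eq]
  rw [h]
  refine MeasurableSet.iInter fun i => measurableSet_le measurable_const ?_
  have := (continuous_id.dist (continuous_const (y := ω i)) : Continuous fun x => dist x (ω i))
  exact ((this.measurable.pow_const s).const_mul lam).sub_const _

lemma integrable_exp_neg_mul_Cfun [MeasurableSpace 𝒳] [OpensMeasurableSpace 𝒳] (P : Measure 𝒳)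
    [IsFiniteMeasure P] {lam t : ℝ} (hlam : 0 ≤ lam) (ht : 0 ≤ t) (u : Fin n → ℝ) :
    Integrable (fun x => Real.exp (-(t * Cfun hn s ω lam u x))) P := by
  refine Integrable.of_bound (C := Real.exp (t * ∑ i, |u i|)) ?_ (ae_of_all _ fun x => ?_)
  · exact (((measurable_Cfun lam u).const_mul t).neg.exp).aestronglyMeasurable
  · rw [Real.norm_eq_abs, Real.abs_exp]
    refine Real.exp_le_exp.2 ?_
    have := mul_le_mul_of_nonneg_left (neg_sum_abs_le_Cfun (hn := hn) (s := s) (ω := ω) hlam u x) ht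
    linarith

lemma integrable_exp_neg_Cfun [MeasurableSpace 𝒳] [OpensMeasurableSpace 𝒳] (P : Measure 𝒳)
    [IsFiniteMeasure P] {lam : ℝ} (hlam : 0 ≤ lam) (u : Fin n → ℝ) :
    Integrable (fun x => Real.exp (-(Cfun hn s ω lam u x))) P := by
  simpa using integrable_exp_neg_mul_Cfun P (t := 1) hlam zero_le_one u

end Cfun

/-- A one-sided derivative bound at `0` for the moment generating function of `-g` bounds the
mean of `g`. -/
lemma integrable_and_integral_le_of_one_sub_integral_exp_le {α : Type*} [MeasurableSpace α]
    {P : Measure α} [IsProbabilityMeasure P] {g : α → ℝ} (hg : Measurable g) {B : ℝ}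
    (hint : ∀ t, 0 < t → t ≤ 1 / 2 → Integrable (fun x => Real.exp (-(t * g x))) P)
    (hB : ∀ t, 0 < t → t ≤ 1 / 2 → 1 - ∫ x, Real.exp (-(t * g x)) ∂P ≤ t * B) :
    Integrable g P ∧ ∫ x, g x ∂P ≤ B := by
  set G : ℝ → α → ℝ := fun t x => (1 - Real.exp (-(t * g x))) / t with hG
  have hGle : ∀ t, 0 < t → ∀ x, G t x ≤ g x := by
    intro t ht x
    rw [hG, div_le_iff₀ ht]
    linarith [Real.add_one_le_exp (-(t * g x))]
  have hGmono : ∀ t, 0 < t → t ≤ 1 / 2 → ∀ x, G (1 / 2) x ≤ G t x := by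
    intro t ht ht2 x
    have hc := convexOn_exp.2 (Set.mem_univ (-(1 / 2 * g x))) (Set.mem_univ 0)
      (by linarith : 0 ≤ 2 * t) (by linarith : 0 ≤ 1 - 2 * t) (by ring)
    simp only [smul_eq_mul, mul_zero, add_zero, Real.exp_zero, mul_one] at hc
    rw [show 2 * t * -(1 / 2 * g x) = -(t * g x) by ring] at hc
    simp only [hG]
    rw [le_div_iff₀ ht]
    linarith
  have hGint : ∀ t, 0 < t → t ≤ 1 / 2 → Integrable (G t) P := fun t h0 h1 =>
    ((integrable_const 1).sub (hint t h0 h1)).div_const t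
  have hGB : ∀ t, 0 < t → t ≤ 1 / 2 → ∫ x, G t x ∂P ≤ B := by
    intro t h0 h1
    simp only [hG]
    rw [integral_div, integral_sub (integrable_const 1) (hint t h0 h1), div_le_iff₀ h0]
    simpa [mul_comm] using hB t h0 h1
  let τ : ℕ → ℝ := fun k => 1 / ((k : ℝ) + 2)
  have hτ0 : ∀ k, 0 < τ k := fun k => by positivity
  have hτ1 : ∀ k, τ k ≤ 1 / 2 := fun k =>
    one_div_le_one_div_of_le two_pos (by linarith [(Nat.cast_nonneg k : (0 : ℝ) ≤ k)])
  have hτ : Filter.Tendsto τ Filter.atTop (nhdsWithin 0 {0}ᶜ) := by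
    refine tendsto_nhdsWithin_iff.2 ⟨?_, Filter.Eventually.of_forall fun k => (hτ0 k).ne'⟩
    have := (Filter.tendsto_add_atTop_iff_nat 1).2
      (tendsto_one_div_add_atTop_nhds_zero_nat (𝕜 := ℝ))
    refine this.congr fun k => ?_
    simp only [τ]
    push_cast
    ring_nf
  have hlim : ∀ x, Filter.Tendsto (fun k => G (τ k) x) Filter.atTop (nhds (g x)) := by
    intro x
    have hd : HasDerivAt (fun t : ℝ => -Real.exp (-(t * g x))) (g x) 0 := by
      have := (((hasDerivAt_id' (0 : ℝ)).mul_const (g x)).fun_neg.exp).fun_neg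
      simpa using this
    refine (hd.tendsto_slope.comp hτ).congr fun k => ?_
    simp [slope_def_field, hG]
    ring
  set b := ∫ x, G (1 / 2) x ∂P
  have hh := hGint (1 / 2) (by norm_num) le_rfl
  have hfatou : ∫⁻ x, ENNReal.ofReal (g x - G (1 / 2) x) ∂P ≤ ENNReal.ofReal (B - b) := by
    have hmeas : ∀ t, Measurable (G t) := fun t => by
      simp only [hG]
      fun_prop
    calc ∫⁻ x, ENNReal.ofReal (g x - G (1 / 2) x) ∂P
        = ∫⁻ x, Filter.liminf (fun k => ENNReal.ofReal (G (τ k) x - G (1 / 2) x))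
            Filter.atTop ∂P := by
          refine lintegral_congr fun x => ?_
          exact ((ENNReal.tendsto_ofReal ((hlim x).sub_const _)).liminf_eq).symm
      _ ≤ Filter.liminf (fun k => ∫⁻ x, ENNReal.ofReal (G (τ k) x - G (1 / 2) x) ∂P)
            Filter.atTop :=
          lintegral_liminf_le fun k => ((hmeas _).sub (hmeas _)).ennreal_ofReal
      _ ≤ ENNReal.ofReal (B - b) := by
          refine (Filter.liminf_le_liminf (v := fun _ => ENNReal.ofReal (B - b))
            (Filter.Eventually.of_forall fun k => ?_)).trans (by simp)
          have hk := hGint _ (hτ0 k) (hτ1 k)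
          have hsub : Integrable (fun x => G (τ k) x - G (1 / 2) x) P := hk.sub hh
          rw [← ofReal_integral_eq_lintegral_ofReal hsub
            (ae_of_all _ fun x => sub_nonneg.2 (hGmono _ (hτ0 k) (hτ1 k) x))]
          refine ENNReal.ofReal_le_ofReal ?_
          rw [integral_sub hk hh]
          linarith [hGB _ (hτ0 k) (hτ1 k)]
  have hnn : ∀ x, 0 ≤ g x - G (1 / 2) x := fun x => sub_nonneg.2 (hGle _ (by norm_num) x)
  have hsub : Integrable (fun x => g x - G (1 / 2) x) P := by
    refine ⟨hg.aestronglyMeasurable.sub hh.1, ?_⟩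
    rw [hasFiniteIntegral_iff_ofReal (ae_of_all _ hnn)]
    exact hfatou.trans_lt ENNReal.ofReal_lt_top
  have hgint : Integrable g P := by
    have := hsub.add hh
    simpa [Pi.add_def] using this
  refine ⟨hgint, ?_⟩
  have hbB : b ≤ B := hGB _ (by norm_num) le_rfl
  rw [← ofReal_integral_eq_lintegral_ofReal hsub (ae_of_all _ hnn),
    ENNReal.ofReal_le_ofReal_iff (by linarith), integral_sub hgint hh] at hfatou
  linarith

section Duality

variable {𝒳 : Type*} [MeasurableSpace 𝒳] {n : ℕ}

/-- The costs and mass vectors of the decompositions `P = ∑ i, ν i`, where mass in `ν i` pays the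
cost `c i`; the first coordinate ranges over upper bounds of the total cost. -/
def transportRange (P : Measure 𝒳) (c : Fin n → 𝒳 → ℝ) : Set (ℝ × (Fin n → ℝ)) :=
  {z | ∃ ν : Fin n → Measure 𝒳, ∑ i, ν i = P ∧ (∀ i, (ν i).real Set.univ = z.2 i) ∧
    (∀ i, Integrable (c i) (ν i)) ∧ ∑ i, ∫ x, c i x ∂(ν i) ≤ z.1}

lemma isFiniteMeasure_of_sum_eq {P : Measure 𝒳} [IsFiniteMeasure P] {ν : Fin n → Measure 𝒳}
    (h : ∑ i, ν i = P) (i : Fin n) : IsFiniteMeasure (ν i) := by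
  refine isFiniteMeasure_of_le P ?_
  rw [← h]
  exact Finset.single_le_sum (f := ν) (fun j _ => Measure.zero_le _) (Finset.mem_univ i)

lemma convex_transportRange (P : Measure 𝒳) [IsFiniteMeasure P] (c : Fin n → 𝒳 → ℝ) :
    Convex ℝ (transportRange P c) := by
  rintro ⟨w, y⟩ ⟨ν, hν, hy, hi, hw⟩ ⟨w', y'⟩ ⟨ν', hν', hy', hi', hw'⟩ a b ha hb hab
  have := isFiniteMeasure_of_sum_eq hν
  have := isFiniteMeasure_of_sum_eq hν'
  refine ⟨fun i => ENNReal.ofReal a • ν i + ENNReal.ofReal b • ν' i, ?_, fun i => ?_,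
    fun i => ?_, ?_⟩
  · rw [Finset.sum_add_distrib, ← Finset.smul_sum, ← Finset.smul_sum, hν, hν', ← add_smul,
      ← ENNReal.ofReal_add ha hb, hab, ENNReal.ofReal_one, one_smul]
  · have := (ν i).smul_finite (ENNReal.ofReal_ne_top (r := a))
    have := (ν' i).smul_finite (ENNReal.ofReal_ne_top (r := b))
    have h1 : (ν i).real Set.univ = y i := hy i
    have h2 : (ν' i).real Set.univ = y' i := hy' i
    rw [measureReal_add_apply, measureReal_ennreal_smul_apply, measureReal_ennreal_smul_apply,
      h1, h2, ENNReal.toReal_ofReal ha, ENNReal.toReal_ofReal hb]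
    simp
  · exact ((hi i).smul_measure ENNReal.ofReal_ne_top).add_measure
      ((hi' i).smul_measure ENNReal.ofReal_ne_top)
  · have : ∀ i, ∫ x, c i x ∂(ENNReal.ofReal a • ν i + ENNReal.ofReal b • ν' i) =
        a * ∫ x, c i x ∂(ν i) + b * ∫ x, c i x ∂(ν' i) := fun i => by
      rw [integral_add_measure ((hi i).smul_measure ENNReal.ofReal_ne_top)
        ((hi' i).smul_measure ENNReal.ofReal_ne_top), integral_smul_measure,
        integral_smul_measure, ENNReal.toReal_ofReal ha, ENNReal.toReal_ofReal hb, smul_eq_mul,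
        smul_eq_mul]
    simp only [this, Finset.sum_add_distrib, ← Finset.mul_sum]
    exact add_le_add (mul_le_mul_of_nonneg_left hw ha) (mul_le_mul_of_nonneg_left hw' hb)

/-- A finite measurable partition subordinate to the pointwise minimizers of a family. -/
lemma exists_sum_integral_eq_integral_min {P : Measure 𝒳} {f : Fin n → 𝒳 → ℝ} {m : 𝒳 → ℝ}
    (hf : ∀ i, Measurable (f i)) (hm : Measurable m) (hfi : ∀ i, Integrable (f i) P)
    (hex : ∀ x, ∃ i, m x = f i x) :
    ∃ A : Fin n → Set 𝒳, ∑ i, P.restrict (A i) = P ∧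
      ∑ i, ∫ x in A i, f i x ∂P = ∫ x, m x ∂P := by
  let A : Fin n → Set 𝒳 := disjointed fun i => {x | m x = f i x}
  have hAm : ∀ i, MeasurableSet (A i) := fun i => by
    refine disjointedRec (fun _ j ht => ht.diff ?_) (measurableSet_eq_fun hm (hf i))
    exact measurableSet_eq_fun hm (hf j)
  have hdisj : Pairwise (Function.onFun Disjoint A) := disjoint_disjointed _
  have hU : ⋃ i, A i = Set.univ := by
    rw [iUnion_disjointed]
    exact Set.eq_univ_of_forall fun x => Set.mem_iUnion.2 (hex x)
  have hsum : ∑ i, P.restrict (A i) = P := by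
    rw [← Measure.sum_fintype, ← Measure.restrict_iUnion hdisj hAm, hU, Measure.restrict_univ]
  have heq : ∀ i, Set.EqOn (f i) m (A i) := fun i x hx =>
    ((disjointed_subset (fun i => {x | m x = f i x}) i hx : m x = f i x)).symm
  refine ⟨A, hsum, ?_⟩
  conv_rhs => rw [← hsum]
  rw [integral_finsetSum_measure fun i _ =>
    ((hfi i).integrableOn.congr_fun (heq i) (hAm i) : IntegrableOn m (A i) P)]
  exact Finset.sum_congr rfl fun i _ => setIntegral_congr_fun (hAm i) (heq i)

lemma mem_closure_transportRange {P : Measure 𝒳} [IsProbabilityMeasure P] {c : Fin n → 𝒳 → ℝ}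
    (hn : 1 ≤ n) (hc : ∀ i, Measurable (c i)) (hci : ∀ i, Integrable (c i) P)
    {m : (Fin n → ℝ) → 𝒳 → ℝ} (hm : ∀ v, Measurable (m v))
    (hex : ∀ v x, ∃ i, m v x = c i x - v i) {R : ℝ}
    (hR : ∀ v, (1 / n : ℝ) * ∑ i, v i + ∫ x, m v x ∂P ≤ R) :
    ((R, fun _ => (1 / n : ℝ)) : ℝ × (Fin n → ℝ)) ∈ closure (transportRange P c) := by
  have hn0 : (0 : ℝ) < n := by exact_mod_cast hn
  by_contra hnot
  obtain ⟨f, a, hfa, haf⟩ := geometric_hahn_banach_point_closed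
    (convex_transportRange P c).closure isClosed_closure hnot
  set α := f (1, 0) with hα
  set β : Fin n → ℝ := fun i => f (0, Pi.single i 1) with hβ
  have hf : ∀ w y, f (w, y) = w * α + ∑ i, y i * β i := by
    intro w y
    have h1 : ((w, y) : ℝ × (Fin n → ℝ)) =
        w • ((1, 0) : ℝ × (Fin n → ℝ)) + ∑ i, y i • ((0, Pi.single i 1) : ℝ × (Fin n → ℝ)) := by
      ext j
      · simp [Prod.fst_sum]
      · simp [Prod.snd_sum, Finset.sum_apply, Pi.single_apply]
    rw [h1, map_add, map_sum, map_smul]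
    simp only [map_smul, smul_eq_mul, hα, hβ]
  have hlow : ∀ z ∈ transportRange P c, f (R, fun _ => (1 / n : ℝ)) < f z := fun z hz =>
    hfa.trans (haf z (subset_closure hz))
  have hconst : ∀ i : Fin n, ∀ w, ∫ x, c i x ∂P ≤ w →
      ((w, Pi.single i 1) : ℝ × (Fin n → ℝ)) ∈ transportRange P c := by
    intro i w hw
    refine ⟨fun j => if j = i then P else 0, by simp, fun j => ?_, fun j => ?_, ?_⟩
    · by_cases hj : j = i <;> simp [hj]
    · by_cases hj : j = i <;> simp [hj, hci i]
    · rw [Finset.sum_eq_single i (fun j _ hj => by simp [hj]) (by simp)]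
      simpa using hw
  have hsingle : ∀ i, ∑ j, (Pi.single i (1 : ℝ) : Fin n → ℝ) j * β j = β i := fun i => by
    simp [Pi.single_apply]
  have hα0 : 0 ≤ α := by
    by_contra hneg
    push Not at hneg
    let i : Fin n := ⟨0, hn⟩
    set K := f (R, fun _ => (1 / n : ℝ)) with hK
    set w := max (∫ x, c i x ∂P) ((K - β i) / α) with hw
    have h1 := hlow _ (hconst i w (le_max_left _ _))
    rw [hf w, hsingle] at h1
    have h3 : (K - β i) / α ≤ w := le_max_right _ _
    rw [div_le_iff_of_neg hneg] at h3
    linarith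
  have hpt : f (R, fun _ => (1 / n : ℝ)) = R * α + (1 / n : ℝ) * ∑ i, β i := by
    rw [hf, Finset.mul_sum]
  rcases hα0.eq_or_lt with hα0 | hα0
  · obtain ⟨i, -, hi⟩ := Finset.exists_min_image Finset.univ β ⟨⟨0, hn⟩, Finset.mem_univ _⟩
    have h1 := hlow _ (hconst i _ le_rfl)
    rw [hpt, hf, hsingle, ← hα0] at h1
    have h2 : (n : ℝ) * β i ≤ ∑ j, β j := by
      simpa using Finset.card_nsmul_le_sum Finset.univ β (β i) fun j hj => hi j hj
    have h3 : β i ≤ (1 / n : ℝ) * ∑ j, β j := by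
      rw [one_div, le_inv_mul_iff₀ hn0]
      exact h2
    linarith
  · set v : Fin n → ℝ := fun i => -(β i / α) with hv
    obtain ⟨A, hA, hAm⟩ := exists_sum_integral_eq_integral_min
      (fun i => (hc i).sub_const (v i)) (hm v) (fun i => (hci i).sub (integrable_const _)) (hex v)
    have h1 := hlow (∑ i, ∫ x in A i, c i x ∂P, fun i => P.real (A i))
      ⟨fun i => P.restrict (A i), hA, fun i => by simp, fun i => (hci i).integrableOn, le_rfl⟩
    have h2 : ∑ i, ∫ x in A i, (c i x - v i) ∂P =
        ∑ i, ∫ x in A i, c i x ∂P + (∑ i, P.real (A i) * β i) / α := by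
      rw [Finset.sum_div, ← Finset.sum_add_distrib]
      refine Finset.sum_congr rfl fun i _ => ?_
      rw [integral_sub (hci i).integrableOn (integrable_const _)]
      simp [hv]
      ring
    rw [hpt, hf] at h1
    have h3 := hR v
    rw [← hAm, h2] at h3
    have h4 : ∑ i, v i = -(∑ i, β i) / α := by
      simp [hv, neg_div, Finset.sum_div]
    rw [h4] at h3
    have h5 := mul_le_mul_of_nonneg_left h3 hα0.le
    have h6 : α * (1 / n * (-(∑ i, β i) / α) + (∑ i, ∫ x in A i, c i x ∂P +
        (∑ i, P.real (A i) * β i) / α)) = -(1 / n * ∑ i, β i) +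
        (∑ i, ∫ x in A i, c i x ∂P) * α + ∑ i, P.real (A i) * β i := by
      field_simp
      ring
    linarith

/-- Semi-discrete Kantorovich duality: a bound on the dual objective produces nearly optimal
transport plans from `P` to the uniform distribution on `n` atoms. -/
lemma exists_transport_of_dual_le {P : Measure 𝒳} [IsProbabilityMeasure P] {c : Fin n → 𝒳 → ℝ}
    (hn : 1 ≤ n) (hc : ∀ i, Measurable (c i)) (hci : ∀ i, Integrable (c i) P)
    (hc0 : ∀ i x, 0 ≤ c i x)
    {m : (Fin n → ℝ) → 𝒳 → ℝ} (hm : ∀ v, Measurable (m v))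
    (hex : ∀ v x, ∃ i, m v x = c i x - v i) {R : ℝ}
    (hR : ∀ v, (1 / n : ℝ) * ∑ i, v i + ∫ x, m v x ∂P ≤ R) {ε : ℝ} (hε : 0 < ε) :
    ∃ ν : Fin n → Measure 𝒳, ∑ i, ν i = P ∧ (∀ i, ν i Set.univ = (n : ℝ≥0∞)⁻¹) ∧
      (∀ i, Integrable (c i) (ν i)) ∧ ∑ i, ∫ x, c i x ∂(ν i) ≤ R + ε := by
  have hn0 : (0 : ℝ) < n := by exact_mod_cast hn
  set K := ∑ i, ∫ x, c i x ∂P with hK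
  have hK0 : 0 ≤ K := Finset.sum_nonneg fun i _ => integral_nonneg (hc0 i)
  set δ := ε / (1 + n * K) with hδ
  have hδ0 : 0 < δ := by positivity
  obtain ⟨⟨w, y⟩, ⟨ν, hν, hy, hνi, hw⟩, hd⟩ := Metric.mem_closure_iff.1
    (mem_closure_transportRange hn hc hci hm hex hR) δ hδ0
  have := isFiniteMeasure_of_sum_eq hν
  rw [Prod.dist_eq, max_lt_iff] at hd
  have hwδ : w < R + δ := by
    have := hd.1
    rw [Real.dist_eq, abs_lt] at this
    linarith [this.1]
  have hyδ : ∀ i, y i < 1 / n + δ := fun i => by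
    have := (dist_le_pi_dist (fun _ : Fin n => (1 / n : ℝ)) y i).trans_lt hd.2
    rw [Real.dist_eq, abs_lt] at this
    linarith [this.1]
  have hy1 : ∑ i, y i = 1 := by
    have h1 : ∑ i, (ν i).real Set.univ = 1 := by
      have h2 : ((∑ i, ν i) Set.univ).toReal = 1 := by simp [hν]
      rw [Measure.finsetSum_apply, ENNReal.toReal_sum fun i _ => measure_ne_top _ _] at h2
      exact h2
    rw [← h1]
    exact Finset.sum_congr rfl fun i _ => (hy i).symm
  set κ := 1 / (1 + n * δ) with hκ
  have hnδ : 0 < n * δ := by positivity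
  have hκ0 : 0 ≤ κ := by positivity
  have hκ1 : κ ≤ 1 := by
    rw [hκ, div_le_one (by positivity)]
    linarith
  have hκn : κ * (1 / n + δ) = 1 / n := by
    rw [hκ]
    field_simp
  have hκδ : 1 - κ ≤ n * δ := by
    have : 1 - κ = κ * (n * δ) := by
      rw [hκ]
      field_simp
      ring
    rw [this]
    exact mul_le_of_le_one_left hnδ.le hκ1
  set b : Fin n → ℝ := fun i => 1 / n - κ * y i with hb
  have hb0 : ∀ i, 0 ≤ b i := fun i => by
    have := mul_le_mul_of_nonneg_left (hyδ i).le hκ0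
    simp only [hb]
    linarith
  have hbsum : ∑ i, b i = 1 - κ := by
    simp only [hb, Finset.sum_sub_distrib, ← Finset.mul_sum, hy1]
    simp [hn0.ne']
  have hνi' := fun i => (hνi i).smul_measure (ENNReal.ofReal_ne_top (r := κ))
  have hci' := fun i => (hci i).smul_measure (ENNReal.ofReal_ne_top (r := b i))
  refine ⟨fun i => ENNReal.ofReal κ • ν i + ENNReal.ofReal (b i) • P, ?_, fun i => ?_,
    fun i => (hνi' i).add_measure (hci' i), ?_⟩
  · rw [Finset.sum_add_distrib, ← Finset.smul_sum, ← Finset.sum_smul, hν, ← add_smul,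
      ← ENNReal.ofReal_sum_of_nonneg fun i _ => hb0 i, hbsum,
      ← ENNReal.ofReal_add hκ0 (by linarith), add_sub_cancel, ENNReal.ofReal_one, one_smul]
  · have h1 : ν i Set.univ = ENNReal.ofReal (y i) := by
      rw [← ofReal_measureReal, hy i]
    rw [Measure.add_apply, Measure.smul_apply, Measure.smul_apply, h1, measure_univ, smul_eq_mul,
      smul_eq_mul, mul_one, ← ENNReal.ofReal_mul hκ0, ← ENNReal.ofReal_add _ (hb0 i)]
    · simp only [hb, add_sub_cancel]
      rw [one_div, ENNReal.ofReal_inv_of_pos hn0, ENNReal.ofReal_natCast]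
    · have : 0 ≤ y i := measureReal_nonneg.trans_eq (hy i)
      positivity
  · have h1 : ∀ i, ∫ x, c i x ∂(ENNReal.ofReal κ • ν i + ENNReal.ofReal (b i) • P) =
        κ * ∫ x, c i x ∂(ν i) + b i * ∫ x, c i x ∂P := fun i => by
      rw [integral_add_measure (hνi' i) (hci' i), integral_smul_measure, integral_smul_measure,
        ENNReal.toReal_ofReal hκ0, ENNReal.toReal_ofReal (hb0 i), smul_eq_mul, smul_eq_mul]
    simp only [h1, Finset.sum_add_distrib, ← Finset.mul_sum]
    have h2 : κ * ∑ i, ∫ x, c i x ∂(ν i) ≤ R + δ := by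
      refine (mul_le_of_le_one_left (Finset.sum_nonneg fun i _ => integral_nonneg (hc0 i))
        hκ1).trans ?_
      exact le_trans hw hwδ.le
    have h3 : ∑ i, b i * ∫ x, c i x ∂P ≤ n * δ * K := by
      rw [hK, Finset.mul_sum]
      refine Finset.sum_le_sum fun i _ =>
        mul_le_mul_of_nonneg_right ?_ (integral_nonneg (hc0 i))
      refine (Finset.single_le_sum (fun j _ => hb0 j) (Finset.mem_univ i)).trans ?_
      rw [hbsum]
      exact hκδ
    have h4 : δ + n * δ * K = ε := by
      rw [hδ]
      field_simp
    linarith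

end Duality

lemma integrable_dist_rpow {𝒳 : Type*} [PseudoMetricSpace 𝒳] [MeasurableSpace 𝒳]
    [OpensMeasurableSpace 𝒳] {n : ℕ} {s : ℝ} {ω : Fin n → 𝒳} (hs : 0 ≤ s)
    {P : Measure 𝒳} [IsFiniteMeasure P] {g : 𝒳 → ℝ} (hg : Integrable g P)
    (hgx : ∀ x, ∃ i, g x = dist x (ω i) ^ s) (i : Fin n) :
    Integrable (fun x => dist x (ω i) ^ s) P := by
  set D := ∑ j, dist (ω j) (ω i) with hD
  have hD0 : 0 ≤ D := Finset.sum_nonneg fun j _ => dist_nonneg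
  have hcont : Continuous fun x => dist x (ω i) := continuous_id.dist continuous_const
  refine Integrable.mono' ((hg.add (integrable_const (D ^ s))).const_mul (2 ^ s))
    (hcont.measurable.pow_const s).aestronglyMeasurable (ae_of_all _ fun x => ?_)
  obtain ⟨j, hj⟩ := hgx x
  have hjD : dist (ω j) (ω i) ≤ D :=
    Finset.single_le_sum (f := fun j => dist (ω j) (ω i)) (fun j _ => dist_nonneg)
      (Finset.mem_univ j)
  rw [Real.norm_of_nonneg (by positivity)]
  simp only [Pi.add_apply, hj]
  set a := dist x (ω j)
  have ha : 0 ≤ a := dist_nonneg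
  have h1 : dist x (ω i) ≤ 2 * max a D := by
    have := dist_triangle x (ω j) (ω i)
    have := le_max_left a D
    have := le_max_right a D
    linarith
  have h2 : max a D ^ s ≤ a ^ s + D ^ s := by
    rcases max_choice a D with h | h <;> rw [h]
    · linarith [Real.rpow_nonneg hD0 s]
    · linarith [Real.rpow_nonneg ha s]
  calc dist x (ω i) ^ s ≤ (2 * max a D) ^ s := Real.rpow_le_rpow dist_nonneg h1 hs
    _ = 2 ^ s * max a D ^ s := Real.mul_rpow two_pos.le (le_max_of_le_left ha)
    _ ≤ 2 ^ s * (a ^ s + D ^ s) := mul_le_mul_of_nonneg_left h2 (by positivity)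

section Wasserstein

variable {𝒳 : Type*} [PseudoMetricSpace 𝒳] [SecondCountableTopology 𝒳] [MeasurableSpace 𝒳]
  [OpensMeasurableSpace 𝒳] {n : ℕ} {s : ℝ} {ω : Fin n → 𝒳}

/-- A decomposition of `P` into `n` pieces of equal mass induces a coupling with the empirical
measure. -/
lemma iInf_coupling_le_of_sum_eq {P : Measure 𝒳} [IsProbabilityMeasure P]
    {ν : Fin n → Measure 𝒳} (hν : ∑ i, ν i = P) (hmass : ∀ i, ν i Set.univ = (n : ℝ≥0∞)⁻¹) :
    (⨅ Γ ∈ {Γ : Measure (𝒳 × 𝒳) | IsProbabilityMeasure Γ ∧ Γ.map Prod.fst = P ∧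
      Γ.map Prod.snd = (n : ℝ≥0∞)⁻¹ • ∑ i, Measure.dirac (ω i)},
      ∫⁻ p, ENNReal.ofReal (dist p.1 p.2 ^ s) ∂Γ) ≤
      ∑ i, ∫⁻ x, ENNReal.ofReal (dist x (ω i) ^ s) ∂(ν i) := by
  have hmeas : ∀ i, Measurable fun x : 𝒳 => (x, ω i) := fun i => by fun_prop
  set Γ : Measure (𝒳 × 𝒳) := ∑ i, (ν i).map fun x => (x, ω i) with hΓ
  have hfst : Γ.map Prod.fst = P := by
    rw [hΓ, ← Measure.mapₗ_apply_of_measurable measurable_fst, map_sum, ← hν]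
    refine Finset.sum_congr rfl fun i _ => ?_
    rw [Measure.mapₗ_apply_of_measurable measurable_fst, Measure.map_map measurable_fst (hmeas i)]
    exact Measure.map_id
  have hsnd : Γ.map Prod.snd = (n : ℝ≥0∞)⁻¹ • ∑ i, Measure.dirac (ω i) := by
    rw [hΓ, ← Measure.mapₗ_apply_of_measurable measurable_snd, map_sum, Finset.smul_sum]
    refine Finset.sum_congr rfl fun i _ => ?_
    rw [Measure.mapₗ_apply_of_measurable measurable_snd, Measure.map_map measurable_snd (hmeas i)]
    exact (Measure.map_const _ _).trans (by rw [hmass])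
  have hprob : IsProbabilityMeasure Γ := by
    refine ⟨?_⟩
    have h1 : Γ.map Prod.fst Set.univ = 1 := by rw [hfst, measure_univ]
    rwa [Measure.map_apply measurable_fst MeasurableSet.univ] at h1
  refine (iInf₂_le Γ ⟨hprob, hfst, hsnd⟩).trans_eq ?_
  rw [hΓ, lintegral_finsetSum_measure]
  refine Finset.sum_congr rfl fun i _ => lintegral_map ?_ (hmeas i)
  have := (continuous_dist (α := 𝒳)).measurable.pow_const s
  exact this.ennreal_ofReal

/-- Weak duality: the cost of any coupling with the empirical measure bounds the mean of
`Cfun`. -/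
lemma integrable_Cfun_and_integral_le [MeasurableSingletonClass 𝒳] {hn : 1 ≤ n} {lam : ℝ}
    (hlam : 0 ≤ lam) (u : Fin n → ℝ) {P : Measure 𝒳} {Γ : Measure (𝒳 × 𝒳)}
    [IsProbabilityMeasure Γ] (hfst : Γ.map Prod.fst = P)
    (hsnd : Γ.map Prod.snd = (n : ℝ≥0∞)⁻¹ • ∑ i, Measure.dirac (ω i))
    (hcost : ∫⁻ p, ENNReal.ofReal (dist p.1 p.2 ^ s) ∂Γ ≠ ∞) :
    Integrable (Cfun hn s ω lam u) P ∧ ∫ x, Cfun hn s ω lam u x ∂P ≤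
      lam * (∫⁻ p, ENNReal.ofReal (dist p.1 p.2 ^ s) ∂Γ).toReal - (1 / n : ℝ) * ∑ i, u i := by
  classical
  have hn0 : (n : ℝ≥0∞) ≠ 0 := by exact_mod_cast (by omega : n ≠ 0)
  have hnonneg : ∀ p : 𝒳 × 𝒳, 0 ≤ dist p.1 p.2 ^ s := fun p => by positivity
  have hdm : Measurable fun p : 𝒳 × 𝒳 => dist p.1 p.2 ^ s :=
    (continuous_dist (α := 𝒳)).measurable.pow_const s
  have hdint : Integrable (fun p : 𝒳 × 𝒳 => dist p.1 p.2 ^ s) Γ := by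
    refine ⟨hdm.aestronglyMeasurable, ?_⟩
    rw [hasFiniteIntegral_iff_ofReal (ae_of_all _ hnonneg)]
    exact hcost.lt_top
  have hdval : ∫ p, dist p.1 p.2 ^ s ∂Γ =
      (∫⁻ p, ENNReal.ofReal (dist p.1 p.2 ^ s) ∂Γ).toReal :=
    integral_eq_lintegral_of_nonneg_ae (ae_of_all _ hnonneg) hdm.aestronglyMeasurable
  -- repeated atoms receive the largest of their potentials
  obtain ⟨U, hU1, hU2⟩ : ∃ U : 𝒳 → ℝ, (∀ i, u i ≤ U (ω i)) ∧
      ∀ i, ∃ j, ω j = ω i ∧ U (ω i) = u j := by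
    have hmax : ∀ i, ∃ j, ω j = ω i ∧ ∀ k, ω k = ω i → u k ≤ u j := fun i => by
      obtain ⟨j, hj, hj'⟩ := Finset.exists_max_image
        (Finset.univ.filter fun k => ω k = ω i) u ⟨i, by simp⟩
      exact ⟨j, by simpa using hj, fun k hk => hj' k (by simpa using hk)⟩
    choose J hJ1 hJ2 using hmax
    refine ⟨fun y => if h : ∃ i, ω i = y then u (J h.choose) else 0, fun i => ?_, fun i => ?_⟩
    · have h : ∃ k, ω k = ω i := ⟨i, rfl⟩
      simp only [h, dite_true]
      exact hJ2 _ _ h.choose_spec.symm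
    · have h : ∃ k, ω k = ω i := ⟨i, rfl⟩
      exact ⟨J h.choose, (hJ1 _).trans h.choose_spec, by simp only [h, dite_true]⟩
  have hUdirac : ∀ i, Integrable U (Measure.dirac (ω i)) := fun i =>
    integrable_dirac enorm_lt_top
  have hUsum : Integrable U (∑ i, Measure.dirac (ω i)) :=
    integrable_finsetSum_measure.2 fun i _ => hUdirac i
  have hUint : Integrable U (Γ.map Prod.snd) := by
    rw [hsnd]
    exact hUsum.smul_measure (ENNReal.inv_ne_top.2 hn0)
  have hUΓ : Integrable (fun p : 𝒳 × 𝒳 => U p.2) Γ := hUint.comp_measurable measurable_snd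
  have hUval : ∫ p, U p.2 ∂Γ = (1 / n : ℝ) * ∑ i, U (ω i) := by
    rw [← integral_map measurable_snd.aemeasurable hUint.1, hsnd, integral_smul_measure,
      integral_finsetSum_measure fun i _ => hUdirac i]
    simp
  have hsupp : ∀ᵐ p ∂Γ, p.2 ∈ Set.range ω := by
    have hm : MeasurableSet (Set.range ω) := (Set.finite_range ω).measurableSet
    refine (ae_map_iff measurable_snd.aemeasurable hm).1 ?_
    rw [hsnd, ae_iff]
    simp [Measure.finsetSum_apply]
  have hbound : ∀ᵐ p ∂Γ, Cfun hn s ω lam u p.1 ≤ lam * dist p.1 p.2 ^ s - U p.2 := by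
    filter_upwards [hsupp] with p hp
    obtain ⟨i, hi⟩ := hp
    obtain ⟨j, hj, hUj⟩ := hU2 i
    rw [← hi, hUj, ← hj]
    exact Cfun_le _ _ _ j
  have hrhs : Integrable (fun p : 𝒳 × 𝒳 => lam * dist p.1 p.2 ^ s - U p.2) Γ :=
    (hdint.const_mul lam).sub hUΓ
  have hCΓ : Integrable (fun p : 𝒳 × 𝒳 => Cfun hn s ω lam u p.1) Γ := by
    refine integrable_of_le_of_le (g₁ := fun _ => -∑ i, |u i|)
      ((measurable_Cfun lam u).comp measurable_fst).aestronglyMeasurable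
      (ae_of_all _ fun p => neg_sum_abs_le_Cfun hlam u p.1) hbound (integrable_const _) hrhs
  subst hfst
  have hCm : AEStronglyMeasurable (Cfun hn s ω lam u) (Γ.map Prod.fst) :=
    (measurable_Cfun lam u).aestronglyMeasurable
  refine ⟨(integrable_map_measure hCm measurable_fst.aemeasurable).2 hCΓ, ?_⟩
  rw [integral_map measurable_fst.aemeasurable hCm]
  refine (integral_mono_ae hCΓ hrhs hbound).trans ?_
  rw [integral_sub (hdint.const_mul lam) hUΓ, integral_const_mul, hdval, hUval]
  have : (1 / n : ℝ) * ∑ i, u i ≤ (1 / n : ℝ) * ∑ i, U (ω i) :=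
    mul_le_mul_of_nonneg_left (Finset.sum_le_sum fun i _ => hU1 i) (by positivity)
  linarith

end Wasserstein

section Gibbs

variable {𝒳 : Type*} [MeasurableSpace 𝒳] {Q : Measure 𝒳} [IsProbabilityMeasure Q]

/-- The Gibbs variational inequality for exponential tilting. -/
lemma integral_sub_log_le_integral_llr {P : Measure 𝒳} [IsProbabilityMeasure P] {f : 𝒳 → ℝ}
    (hPQ : P ≪ Q) (hllr : Integrable (llr P Q) P) (hf : Integrable f P)
    (hfQ : Integrable (fun x => Real.exp (f x)) Q) :
    ∫ x, f x ∂P - Real.log (∫ x, Real.exp (f x) ∂Q) ≤ ∫ x, llr P Q x ∂P := by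
  have := isProbabilityMeasure_tilted hfQ
  have h := InformationTheory.integral_llr_add_sub_measure_univ_nonneg
    (hPQ.trans (absolutelyContinuous_tilted hfQ)) (integrable_llr_tilted_right hPQ hf hllr hfQ)
  rw [integral_llr_tilted_right hPQ hf hfQ hllr] at h
  simp only [probReal_univ] at h
  linarith

lemma klDiv_tilted {f : 𝒳 → ℝ} (hf : Integrable f (Q.tilted f))
    (hfQ : Integrable (fun x => Real.exp (f x)) Q) :
    klDiv (Q.tilted f) Q =
      ENNReal.ofReal (∫ x, f x ∂(Q.tilted f) - Real.log (∫ x, Real.exp (f x) ∂Q)) := by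
  have := isProbabilityMeasure_tilted hfQ
  have hac := tilted_absolutelyContinuous Q f
  have hlog : (fun x => Real.log ((Q.tilted f).rnDeriv Q x).toReal) =ᵐ[Q.tilted f]
      fun x => f x - Real.log (∫ x, Real.exp (f x) ∂Q) :=
    hac.ae_le (log_rnDeriv_tilted_left_self hfQ)
  have hint : Integrable (fun x => Real.log ((Q.tilted f).rnDeriv Q x).toReal) (Q.tilted f) :=
    (hf.sub (integrable_const _)).congr hlog.symm
  rw [klDiv, if_pos ⟨hac, hint⟩, integral_congr_ae hlog, integral_sub hf (integrable_const _)]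
  simp

end Gibbs

section Tilting

variable {𝒳 : Type*} [PseudoMetricSpace 𝒳] [MeasurableSpace 𝒳] [OpensMeasurableSpace 𝒳]
  {n : ℕ} {hn : 1 ≤ n} {s : ℝ} {ω : Fin n → 𝒳}

lemma toReal_etaFun {μ Q : Measure 𝒳} {q : 𝒳 → ℝ} (hq : Measurable q) (hq0 : ∀ x, 0 ≤ q x)
    (hQ : Q = μ.withDensity fun x => ENNReal.ofReal (q x)) (lam : ℝ) (u : Fin n → ℝ) :
    (etaFun hn s ω μ q lam u).toReal = ∫ x, Real.exp (-(Cfun hn s ω lam u x)) ∂Q := by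
  have hm : Measurable fun x => Real.exp (-(Cfun hn s ω lam u x)) := (measurable_Cfun lam u).neg.exp
  rw [integral_eq_lintegral_of_nonneg_ae (ae_of_all _ fun x => (Real.exp_pos _).le)
    hm.aestronglyMeasurable, hQ,
    lintegral_withDensity_eq_lintegral_mul _ hq.ennreal_ofReal hm.ennreal_ofReal, etaFun]
  simp only [Pi.mul_apply, ENNReal.ofReal_mul (hq0 _)]

lemma withDensity_eq_tilted {μ Q : Measure 𝒳} {q : 𝒳 → ℝ} (hq : Measurable q)
    (hq0 : ∀ x, 0 ≤ q x) (hQ : Q = μ.withDensity fun x => ENNReal.ofReal (q x)) (lam : ℝ)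
    (u : Fin n → ℝ) :
    (μ.withDensity fun x => ENNReal.ofReal
      (q x * Real.exp (-(Cfun hn s ω lam u x)) / (etaFun hn s ω μ q lam u).toReal)) =
      Q.tilted fun x => -(Cfun hn s ω lam u x) := by
  have hm : Measurable fun x => Real.exp (-(Cfun hn s ω lam u x)) := (measurable_Cfun lam u).neg.exp
  rw [toReal_etaFun hq hq0 hQ, Measure.tilted]
  conv_rhs => rw [hQ]
  rw [← withDensity_mul _ hq.ennreal_ofReal (hm.div_const _).ennreal_ofReal, ← hQ]
  congr 1
  ext x
  rw [Pi.mul_apply, ← ENNReal.ofReal_mul (hq0 x), mul_div_assoc]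

variable {Q : Measure 𝒳} [IsProbabilityMeasure Q] {ρ lam' : ℝ} {u' : Fin n → ℝ}

/-- Optimality of `(lam', u')` for the dual problem, tested against a competitor through
`log x ≤ x - 1`. -/
lemma one_sub_integral_exp_le_of_isMax (hlam' : 0 ≤ lam')
    (hmax : ∀ lam : ℝ, 0 ≤ lam → ∀ u : Fin n → ℝ,
      -lam * ρ + (1 / n : ℝ) * ∑ i, u i - Real.log (∫ x, Real.exp (-(Cfun hn s ω lam u x)) ∂Q) ≤
        -lam' * ρ + (1 / n : ℝ) * ∑ i, u' i -
          Real.log (∫ x, Real.exp (-(Cfun hn s ω lam' u' x)) ∂Q))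
    {lam : ℝ} (hlam : 0 ≤ lam) (u : Fin n → ℝ) :
    1 - ∫ x, Real.exp (Cfun hn s ω lam' u' x - Cfun hn s ω lam u x)
        ∂(Q.tilted fun x => -(Cfun hn s ω lam' u' x)) ≤
      (-lam' * ρ + (1 / n : ℝ) * ∑ i, u' i) - (-lam * ρ + (1 / n : ℝ) * ∑ i, u i) := by
  have h1 := integral_exp_pos (integrable_exp_neg_Cfun (hn := hn) (s := s) (ω := ω) Q hlam u)
  have h2 := integral_exp_pos (integrable_exp_neg_Cfun (hn := hn) (s := s) (ω := ω) Q hlam' u')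
  rw [integral_exp_tilted]
  have h3 : ∀ x, ((fun x => -(Cfun hn s ω lam' u' x)) + fun x => Cfun hn s ω lam' u' x -
      Cfun hn s ω lam u x) x = -(Cfun hn s ω lam u x) := fun x => by
    simp only [Pi.add_apply]
    ring
  simp only [h3]
  have h4 := Real.log_le_sub_one_of_pos (div_pos h1 h2)
  rw [Real.log_div h1.ne' h2.ne'] at h4
  linarith [hmax lam hlam u]

lemma integrable_and_integral_neg_Cfun_le_of_isMax (hlam' : 0 ≤ lam')
    (hmax : ∀ lam : ℝ, 0 ≤ lam → ∀ u : Fin n → ℝ,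
      -lam * ρ + (1 / n : ℝ) * ∑ i, u i - Real.log (∫ x, Real.exp (-(Cfun hn s ω lam u x)) ∂Q) ≤
        -lam' * ρ + (1 / n : ℝ) * ∑ i, u' i -
          Real.log (∫ x, Real.exp (-(Cfun hn s ω lam' u' x)) ∂Q)) :
    Integrable (fun x => -(Cfun hn s ω lam' u' x)) (Q.tilted fun x => -(Cfun hn s ω lam' u' x)) ∧
      ∫ x, -(Cfun hn s ω lam' u' x) ∂(Q.tilted fun x => -(Cfun hn s ω lam' u' x)) ≤
        -lam' * ρ + (1 / n : ℝ) * ∑ i, u' i := by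
  have hexp := integrable_exp_neg_Cfun (hn := hn) (s := s) (ω := ω) Q hlam' u'
  have := isProbabilityMeasure_tilted hexp
  refine integrable_and_integral_le_of_one_sub_integral_exp_le (measurable_Cfun lam' u').neg
    (fun t ht0 ht1 => ?_) fun t ht0 ht1 => ?_
  · rw [integrable_tilted_iff hexp]
    refine (integrable_exp_neg_mul_Cfun (hn := hn) (s := s) (ω := ω) Q hlam'
      (by linarith : 0 ≤ 1 - t) u').congr (ae_of_all _ fun x => ?_)
    simp only [smul_eq_mul, ← Real.exp_add, Pi.neg_apply]
    ring_nf
  · have h := one_sub_integral_exp_le_of_isMax hlam' hmax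
      (mul_nonneg (by linarith : 0 ≤ 1 - t) hlam') fun i => (1 - t) * u' i
    simp only [Cfun_smul (by linarith : 0 ≤ 1 - t), ← Finset.mul_sum] at h
    have h1 : ∀ x, Cfun hn s ω lam' u' x - (1 - t) * Cfun hn s ω lam' u' x =
        -(t * -(Cfun hn s ω lam' u' x)) := fun x => by ring
    simp only [h1] at h
    refine h.trans_eq ?_
    ring

lemma integrable_and_integral_Cfun_one_le_of_isMax (hlam' : 0 ≤ lam')
    (hmax : ∀ lam : ℝ, 0 ≤ lam → ∀ u : Fin n → ℝ,
      -lam * ρ + (1 / n : ℝ) * ∑ i, u i - Real.log (∫ x, Real.exp (-(Cfun hn s ω lam u x)) ∂Q) ≤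
        -lam' * ρ + (1 / n : ℝ) * ∑ i, u' i -
          Real.log (∫ x, Real.exp (-(Cfun hn s ω lam' u' x)) ∂Q)) (v : Fin n → ℝ) :
    Integrable (Cfun hn s ω 1 v) (Q.tilted fun x => -(Cfun hn s ω lam' u' x)) ∧
      ∫ x, Cfun hn s ω 1 v x ∂(Q.tilted fun x => -(Cfun hn s ω lam' u' x)) ≤
        ρ - (1 / n : ℝ) * ∑ i, v i := by
  have hexp := integrable_exp_neg_Cfun (hn := hn) (s := s) (ω := ω) Q hlam' u'
  have := isProbabilityMeasure_tilted hexp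
  have hint : ∀ t, 0 < t → Integrable (fun x => Real.exp (-(t * Cfun hn s ω 1 v x)))
      (Q.tilted fun x => -(Cfun hn s ω lam' u' x)) := fun t ht =>
    integrable_exp_neg_mul_Cfun _ zero_le_one ht.le v
  refine integrable_and_integral_le_of_one_sub_integral_exp_le (measurable_Cfun 1 v)
    (fun t ht0 _ => hint t ht0) fun t ht0 ht1 => ?_
  have h := one_sub_integral_exp_le_of_isMax hlam' hmax
    (by positivity : 0 ≤ lam' + t * 1) fun i => u' i + t * v i
  have hle : ∫ x, Real.exp (Cfun hn s ω lam' u' x -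
        Cfun hn s ω (lam' + t * 1) (fun i => u' i + t * v i) x)
        ∂(Q.tilted fun x => -(Cfun hn s ω lam' u' x)) ≤
      ∫ x, Real.exp (-(t * Cfun hn s ω 1 v x)) ∂(Q.tilted fun x => -(Cfun hn s ω lam' u' x)) := by
    refine integral_mono_of_nonneg (ae_of_all _ fun x => (Real.exp_pos _).le) (hint t ht0)
      (ae_of_all _ fun x => Real.exp_le_exp.2 ?_)
    linarith [Cfun_add_mul_le (hn := hn) (s := s) (ω := ω) ht0.le lam' 1 u' v x]
  rw [Finset.sum_add_distrib, ← Finset.mul_sum] at h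
  calc _ ≤ _ := sub_le_sub_left hle 1
    _ ≤ _ := h
    _ = _ := by ring

end Tilting

/-- If `(λ*, u*)` attains the maximum of the dual objective
`-λ r^s + (1/n) Σ u_i - log η(λ,u)` over `λ ≥ 0, u ∈ ℝ^n`, with `0 < η(λ*,u*) < ∞`, then
the exponentially tilted measure `P*` with Lebesgue density
`p*(x) = q(x) e^{-C_{λ*,u*}(x)} / η(λ*,u*)` is a probability measure lying in the
Wasserstein ball of radius `r` around `P̂_n` and achieves
`KL(P*‖Q) = inf {KL(P‖Q) : W_s(P, P̂_n) ≤ r}`. -/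
theorem stmt6 (d : ℕ) (n : ℕ) (hn : 1 ≤ n) (s r : ℝ) (hs : 1 ≤ s) (hr : 0 < r)
    (q : EuclideanSpace ℝ (Fin d) → ℝ) (hq : Measurable q) (hq0 : ∀ x, 0 ≤ q x)
    (Q : Measure (EuclideanSpace ℝ (Fin d))) [IsProbabilityMeasure Q]
    (hQ : Q = volume.withDensity fun x => ENNReal.ofReal (q x))
    (ω : Fin n → EuclideanSpace ℝ (Fin d))
    (lamstar : ℝ) (ustar : Fin n → ℝ) (hlamstar : 0 ≤ lamstar)
    (hmax : ∀ lam : ℝ, 0 ≤ lam → ∀ u : Fin n → ℝ,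
      -lam * r ^ s + (1 / n : ℝ) * ∑ i, u i -
          Real.log (etaFun hn s ω volume q lam u).toReal ≤
        -lamstar * r ^ s + (1 / n : ℝ) * ∑ i, ustar i -
          Real.log (etaFun hn s ω volume q lamstar ustar).toReal)
    (hη : 0 < etaFun hn s ω volume q lamstar ustar ∧
      etaFun hn s ω volume q lamstar ustar < ∞) :
    let Phat : Measure (EuclideanSpace ℝ (Fin d)) :=
      (n : ℝ≥0∞)⁻¹ • ∑ i, Measure.dirac (ω i)
    let Pstar : Measure (EuclideanSpace ℝ (Fin d)) :=
      volume.withDensity fun x => ENNReal.ofReal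
        (q x * Real.exp (-(Cfun hn s ω lamstar ustar x)) /
          (etaFun hn s ω volume q lamstar ustar).toReal)
    IsProbabilityMeasure Pstar ∧
      wassE s Pstar Phat ≤ ENNReal.ofReal r ∧
      klDiv Pstar Q = ⨅ P ∈ {P : Measure (EuclideanSpace ℝ (Fin d)) |
          IsProbabilityMeasure P ∧ wassE s P Phat ≤ ENNReal.ofReal r}, klDiv P Q := by
  intro Phat Pstar
  have hη' : ∀ lam u, (etaFun hn s ω volume q lam u).toReal =
      ∫ x, Real.exp (-(Cfun hn s ω lam u x)) ∂Q := fun lam u => toReal_etaFun hq hq0 hQ lam u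
  simp only [hη'] at hmax
  have hexp := integrable_exp_neg_Cfun (hn := hn) (s := s) (ω := ω) Q hlamstar ustar
  have hP : Pstar = Q.tilted fun x => -(Cfun hn s ω lamstar ustar x) :=
    withDensity_eq_tilted hq hq0 hQ lamstar ustar
  have hs0 : 0 < s := by linarith
  have hprob : IsProbabilityMeasure Pstar := hP ▸ isProbabilityMeasure_tilted hexp
  have hdual : ∀ v, Integrable (Cfun hn s ω 1 v) Pstar ∧
      ∫ x, Cfun hn s ω 1 v x ∂Pstar ≤ r ^ s - (1 / n : ℝ) * ∑ i, v i := fun v =>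
    hP ▸ integrable_and_integral_Cfun_one_le_of_isMax hlamstar hmax v
  have hwass : ∀ P : Measure (EuclideanSpace ℝ (Fin d)), wassE s P Phat ≤ ENNReal.ofReal r ↔
      (⨅ Γ ∈ {Γ : Measure (EuclideanSpace ℝ (Fin d) × EuclideanSpace ℝ (Fin d)) |
        IsProbabilityMeasure Γ ∧ Γ.map Prod.fst = P ∧ Γ.map Prod.snd = Phat},
        ∫⁻ p, ENNReal.ofReal (dist p.1 p.2 ^ s) ∂Γ) ≤ ENNReal.ofReal (r ^ s) := fun P => by
    rw [wassE, one_div, ENNReal.rpow_inv_le_iff hs0, ENNReal.ofReal_rpow_of_pos hr]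
  have hfeas : wassE s Pstar Phat ≤ ENNReal.ofReal r := by
    rw [hwass]
    have hint : ∀ i, Integrable (fun x => dist x (ω i) ^ s) Pstar :=
      integrable_dist_rpow hs0.le (hdual 0).1 fun x => by
        simpa using exists_Cfun_eq (hn := hn) (s := s) (ω := ω) 1 0 x
    refine ENNReal.le_of_forall_pos_le_add fun ε hε _ => ?_
    obtain ⟨ν, hν, hmass, hνi, hcost⟩ := exists_transport_of_dual_le (P := Pstar)
      (c := fun i x => dist x (ω i) ^ s) (m := fun v => Cfun hn s ω 1 v) (R := r ^ s) hn
      (fun i => (continuous_id.dist continuous_const).measurable.pow_const s) hint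
      (fun i x => by positivity) (fun v => measurable_Cfun 1 v)
      (fun v x => by simpa using exists_Cfun_eq (hn := hn) (s := s) (ω := ω) 1 v x)
      (fun v => by linarith [(hdual v).2]) (NNReal.coe_pos.2 hε)
    refine (iInf_coupling_le_of_sum_eq hν hmass).trans ?_
    rw [← ENNReal.ofReal_coe_nnreal, ← ENNReal.ofReal_add (by positivity) (NNReal.coe_nonneg ε)]
    have hi : ∀ i, ∫⁻ x, ENNReal.ofReal (dist x (ω i) ^ s) ∂(ν i) =
        ENNReal.ofReal (∫ x, dist x (ω i) ^ s ∂(ν i)) := fun i =>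
      (ofReal_integral_eq_lintegral_ofReal (hνi i) (ae_of_all _ fun x => by positivity)).symm
    simp only [hi]
    rw [← ENNReal.ofReal_sum_of_nonneg fun i _ => integral_nonneg fun x => by positivity]
    exact ENNReal.ofReal_le_ofReal hcost
  refine ⟨hprob, hfeas, le_antisymm (le_iInf₂ ?_) (iInf₂_le Pstar ⟨hprob, hfeas⟩)⟩
  rintro P ⟨hPprob, hPw⟩
  obtain ⟨hCint, hCle⟩ := integrable_and_integral_neg_Cfun_le_of_isMax hlamstar hmax
  rw [hP, klDiv_tilted hCint hexp, klDiv]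
  split_ifs with hcond
  swap
  · exact le_top
  refine ENNReal.ofReal_le_ofReal (le_of_forall_pos_le_add fun ε hε => ?_)
  rw [hwass] at hPw
  have hlt : (⨅ Γ ∈ {Γ : Measure (EuclideanSpace ℝ (Fin d) × EuclideanSpace ℝ (Fin d)) |
      IsProbabilityMeasure Γ ∧ Γ.map Prod.fst = P ∧ Γ.map Prod.snd = Phat},
      ∫⁻ p, ENNReal.ofReal (dist p.1 p.2 ^ s) ∂Γ) <
        ENNReal.ofReal (r ^ s + ε / (lamstar + 1)) :=
    hPw.trans_lt ((ENNReal.ofReal_lt_ofReal_iff (by positivity)).2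
      (lt_add_of_pos_right _ (by positivity)))
  simp only [iInf_lt_iff] at hlt
  obtain ⟨Γ, ⟨hΓ, hfst, hsnd⟩, hcost⟩ := hlt
  obtain ⟨hint, hle⟩ := integrable_Cfun_and_integral_le (hn := hn) hlamstar ustar hfst hsnd
    hcost.ne_top
  have hcost' := ENNReal.toReal_le_of_le_ofReal (by positivity) hcost.le
  have hgibbs := integral_sub_log_le_integral_llr hcond.1 hcond.2 hint.neg hexp
  have hε' : lamstar * (ε / (lamstar + 1)) ≤ ε := by
    rw [mul_div_assoc', div_le_iff₀ (by positivity)]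
    nlinarith
  have h1 := mul_le_mul_of_nonneg_left hcost' hlamstar
  simp only [Pi.neg_apply, integral_neg] at hgibbs
  rw [integral_neg] at hCle ⊢
  change _ ≤ ∫ x, llr P Q x ∂P + ε
  linarith
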